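/- Let m ≥ 2. (1) For every p ≥ 1, ι_m⁻¹(p) = 1 + Σ_{v ∈ V_m} (⌊p/(m+1)^v⌋ − ⌊p/(m+1)^{v+1}⌋) (all but finitely many terms of the sum vanish). (2) The limit ν_m := lim_{x→∞} x/ι_m(x) exists and ν_m = (m/(m+1)) · Σ_{v ∈ V_m} (m+1)^{−v}. (3) For every n ≥ m+1, writing t := t^(m+1)(n) − 1, one has ι_m⁻¹((m+1)^t) − 1 = ⌈ν_m·(m+1)^t⌉. -/

import Mathlib

open List Filter

open scoped Classical

noncomputable section

/-- The curling number of a finite string: the largest `k` such that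
`S = X ++ Y^k` with `Y` nonempty; by convention `curl [] = 1`. -/
def curl (S : List ℕ) : ℕ :=
  max 1 (sSup {k | ∃ X Y : List ℕ, Y ≠ [] ∧ S = X ++ (List.replicate k Y).flatten})

/-- The prefix of length `n` of the level-`m` Gijswijt sequence `A^(m)`. -/
def gPrefix (m : ℕ) : ℕ → List ℕ
  | 0 => []
  | n + 1 => gPrefix m n ++ [max m (curl (gPrefix m n))]

/-- `gij m p` is the `p`-th term (1-indexed) of the level-`m` Gijswijt sequence `A^(m)`. -/
def gij (m p : ℕ) : ℕ := max m (curl (gPrefix m (p - 1)))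

/-- Standing hypothesis: for every `m ≥ 1`, the sets
`{k ≥ 0 : C(A^(m)[1,k]) ≤ m}` and `{k ≥ 0 : C(A^(m+1)[1,k]) ≤ m}` are infinite. -/
def StandingHyp : Prop :=
  ∀ m : ℕ, 1 ≤ m →
    {k : ℕ | curl (gPrefix m k) ≤ m}.Infinite ∧
    {k : ℕ | curl (gPrefix (m + 1) k) ≤ m}.Infinite

/-- Length of `π^(m)(1,x)`: the `x`-th smallest (0-indexed) element of
`{k : C(A^(m)[1,k]) ≤ m}`. -/
def piLen (m x : ℕ) : ℕ := Nat.nth (fun k => curl (gPrefix m k) ≤ m) x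

/-- `π^(m)(1,x)`: the prefix of `A^(m)` with exactly `x` occurrences of `m`
and curling number at most `m`. -/
def piStr (m x : ℕ) : List ℕ := gPrefix m (piLen m x)

/-- `β^(m)(t)`, the length of `B_t^(m)`. -/
def beta (m t : ℕ) : ℕ := piLen m ((m + 1) ^ (t - 1))

/-- `B_t^(m) := π^(m)(1,(m+1)^(t-1))`. -/
def Bstr (m t : ℕ) : List ℕ := piStr m ((m + 1) ^ (t - 1))

/-- `τ^(m)(t)`, the length of `T_t^(m)`. -/
def tau (m t : ℕ) : ℕ := Nat.nth (fun k => curl (gPrefix (m + 1) k) ≤ m) (t - 1)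

/-- `T_t^(m)`: the `t`-th shortest prefix of `A^(m+1)` with curling number at most `m`. -/
def Tstr (m t : ℕ) : List ℕ := gPrefix (m + 1) (tau m t)

/-- `φ^(m)(n)`: the least `p ≥ 1` with `A^(m)(p) = n`. -/
def phi (m n : ℕ) : ℕ := sInf {p : ℕ | 1 ≤ p ∧ gij m p = n}

/-- `t^(m)(n) = 1 + log_{m+1} #\{i ≤ φ^(m)(n) : A^(m)(i) = m\}`. -/
def tfun (m n : ℕ) : ℕ := 1 + Nat.log (m + 1) ((gPrefix m (phi m n)).count m)

/-- `χ^(b)(a)`: read the base-`b` digits of `a` as base-`(b+1)` digits. -/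
def chi (b a : ℕ) : ℕ := Nat.ofDigits (b + 1) (Nat.digits b a)

/-- `ι_m(t)`: read the base-`(m+2)` digits of the number of occurrences of `m+1`
in `T_t^(m)` as base-`(m+1)` digits. -/
def iota (m t : ℕ) : ℕ :=
  Nat.ofDigits (m + 1) (Nat.digits (m + 2) ((Tstr m t).count (m + 1)))

/-- `ι_m⁻¹(p)`: the largest `x ≥ 1` with `ι_m(x) ≤ p`. -/
def iotaInv (m p : ℕ) : ℕ := sSup {x : ℕ | 1 ≤ x ∧ iota m x ≤ p}

/-- `ord_b(n)`: the `b`-adic valuation of `n`. -/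
def ordb (b n : ℕ) : ℕ := sSup {z : ℕ | b ^ z ∣ n}

/-- The largest base-`b` digit of `n`. -/
def maxdigit (b n : ℕ) : ℕ := (Nat.digits b n).foldr max 0

/-- Auxiliary function for the level-`m` expansion: `lexpAux m a k = a_{m+1+k}`. -/
def lexpAux (m a : ℕ) : ℕ → ℕ
  | 0 => a
  | k + 1 => iota (m + 1 + k) (ordb (m + 1 + k) (lexpAux m a k) + 1)

/-- `lexp m a l = a_l`, the `l`-th term of the level-`m` expansion of `a`. -/
def lexp (m a l : ℕ) : ℕ := lexpAux m a (l - (m + 1))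

/-- The last element `n` of `π^(m+1)(1, χ^(m+1)(a))`; the level-`m` expansion
of `a` is `a_{m+1}, …, a_n`. -/
def levelEnd (m a : ℕ) : ℕ := (piStr (m + 1) (chi (m + 1) a)).getLastD 0

/-- `V_m := {v ≥ 0 : C(T_{v+1}^(m+1)) ≤ m}`. -/
def Vset (m : ℕ) : Set ℕ := {v | curl (Tstr (m + 1) (v + 1)) ≤ m}

/-- `Q := {α ≥ 0 : C(T_{α+1}^(2)) = 1}`. -/
def Qset : Set ℕ := {a | curl (Tstr 2 (a + 1)) = 1}

/-- `R := {(a,b) : a ∈ Q, a < b, no suffix S of T_{a+1}^(2) with T_{a+1}^(2)·S = T_{b+1}^(2)}`. -/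
def Rset : Set (ℕ × ℕ) :=
  {p | p.1 ∈ Qset ∧ p.1 < p.2 ∧
    ¬∃ S : List ℕ, S <:+ Tstr 2 (p.1 + 1) ∧ Tstr 2 (p.1 + 1) ++ S = Tstr 2 (p.2 + 1)}

/-- The digit of `x` in base `b` at (1-indexed) position `i`, i.e. the coefficient
of `b^(i-1)`. -/
def digitAt (b x i : ℕ) : ℕ := (Nat.digits b x).getD (i - 1) 0

/-- `u` is the (1-indexed) position of the second nonzero base-`b` digit of `x`
(the first nonzero digit being at position `ord_b(x)+1`). -/
def IsSecondNonzero (b x u : ℕ) : Prop :=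
  ordb b x + 1 < u ∧ digitAt b x u ≠ 0 ∧
    ∀ i, ordb b x + 1 < i → i < u → digitAt b x i = 0

/-- `𝒮_b`: pairs `(a,a')` with `1 ≤ a < a'` such that for some position `y` the
base-`b` digits of `a` and `a'` agree away from `y` and twice the `y`-th digit of `a`
is at least the `y`-th digit of `a'`. -/
def Sset (b : ℕ) : Set (ℕ × ℕ) :=
  {p | 1 ≤ p.1 ∧ p.1 < p.2 ∧
    ∃ y : ℕ, (∀ i, i ≠ y → (Nat.digits b p.1).getD i 0 = (Nat.digits b p.2).getD i 0) ∧
      (Nat.digits b p.2).getD y 0 ≤ 2 * (Nat.digits b p.1).getD y 0}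

/-- The glue string `S_t^(m)`, so that `T_{t+1}^(m) = T_t^(m) ++ glue m t`. -/
def glue (m t : ℕ) : List ℕ := (gPrefix (m + 1) (tau m (t + 1))).drop (tau m t)

/-- The strings `P_t^(m)`: `P_1^(m) = (m)` and `P_{t+1}^(m) = P_t^(m)·B_t^(m)·S_t^(m)`. -/
def Pstr (m : ℕ) : ℕ → List ℕ
  | 0 => []
  | 1 => [m]
  | t + 2 => Pstr m (t + 1) ++ Bstr m (t + 1) ++ glue m (t + 1)

end

/-- `S` ends in a `k`-th power of a nonempty string. -/
def EndsInPow (S : List ℕ) (k : ℕ) : Prop :=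
  ∃ X Y : List ℕ, Y ≠ [] ∧ S = X ++ (List.replicate k Y).flatten

lemma EndsInPow.le_length {S : List ℕ} {k : ℕ} (h : EndsInPow S k) : k ≤ S.length := by
  obtain ⟨X, Y, hY, rfl⟩ := h
  have : 1 ≤ Y.length := List.length_pos_iff.2 hY
  simp only [List.length_append, List.length_flatten, List.map_replicate, List.sum_replicate,
    smul_eq_mul]
  nlinarith

lemma EndsInPow.append_left {S : List ℕ} {k : ℕ} (h : EndsInPow S k) (R : List ℕ) :
    EndsInPow (R ++ S) k := by
  obtain ⟨X, Y, hY, rfl⟩ := h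
  exact ⟨R ++ X, Y, hY, by simp⟩

lemma bddAbove_endsInPow (S : List ℕ) : BddAbove {k | EndsInPow S k} :=
  ⟨S.length, fun _ h => EndsInPow.le_length h⟩

lemma curl_eq (S : List ℕ) : curl S = max 1 (sSup {k | EndsInPow S k}) := rfl

lemma EndsInPow.le_curl {S : List ℕ} {k : ℕ} (h : EndsInPow S k) : k ≤ curl S := by
  rw [curl_eq]
  exact le_max_of_le_right (le_csSup (bddAbove_endsInPow S) h)

lemma endsInPow_one {S : List ℕ} (hS : S ≠ []) : EndsInPow S 1 := ⟨[], S, hS, by simp⟩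

lemma curl_nil : curl [] = 1 := by
  rw [curl_eq]
  refine max_eq_left (csSup_le' fun k hk => ?_)
  simpa using (EndsInPow.le_length hk).trans (Nat.zero_le 1)

lemma curl_le_iff {S : List ℕ} {K : ℕ} (hK : 1 ≤ K) :
    curl S ≤ K ↔ ∀ k, EndsInPow S k → k ≤ K := by
  refine ⟨fun h k hk => hk.le_curl.trans h, fun h => ?_⟩
  rw [curl_eq]
  exact max_le hK (csSup_le' h)

lemma endsInPow_curl {S : List ℕ} (hS : S ≠ []) : EndsInPow S (curl S) := by
  have h1 : 1 ≤ sSup {k | EndsInPow S k} :=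
    le_csSup (bddAbove_endsInPow S) (endsInPow_one hS)
  rw [curl_eq, max_eq_right h1]
  exact Nat.sSup_mem ⟨1, endsInPow_one hS⟩ (bddAbove_endsInPow S)

lemma one_le_curl (S : List ℕ) : 1 ≤ curl S := le_max_left _ _

lemma curl_le_curl_append (R S : List ℕ) : curl S ≤ curl (R ++ S) := by
  rcases eq_or_ne S [] with rfl | hS
  · rw [curl_nil]
    exact one_le_curl _
  · exact ((endsInPow_curl hS).append_left R).le_curl

lemma curl_concat_of_notMem {S : List ℕ} {n : ℕ} (h : n ∉ S) : curl (S ++ [n]) ≤ 1 := by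
  rw [curl_le_iff le_rfl]
  rintro k ⟨X, Y, hY, hS⟩
  by_contra! hk
  have hc : (S ++ [n]).count n = 1 := by simp [List.count_eq_zero_of_not_mem h]
  have hn : n ∈ Y := by
    have h0 : (List.replicate k Y).flatten ≠ [] := by
      simp [hY]
      omega
    have h2 : (S ++ [n]).getLast? = (X ++ (List.replicate k Y).flatten).getLast? := by rw [hS]
    rw [List.getLast?_append_of_ne_nil _ h0, List.getLast?_concat] at h2
    have h3 := List.mem_of_getLast? h2.symm
    simp only [List.mem_flatten, List.mem_replicate] at h3
    obtain ⟨l, ⟨_, rfl⟩, hl⟩ := h3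
    exact hl
  rw [hS, List.count_append, List.count_flatten] at hc
  simp only [List.map_replicate, List.sum_replicate, smul_eq_mul] at hc
  have : 1 ≤ Y.count n := List.count_pos_iff.2 hn
  nlinarith

lemma append_cons_inj_of_notMem_right {M : ℕ} {A A' U U' : List ℕ} (hU : M ∉ U) (hU' : M ∉ U')
    (h : A ++ M :: U = A' ++ M :: U') : A = A' ∧ U = U' := by
  rcases List.append_eq_append_iff.1 h with ⟨B, rfl, hB⟩ | ⟨B, rfl, hB⟩
  · rcases B with _ | ⟨x, B⟩
    · simpa using hB
    · simp only [List.cons_append, List.cons.injEq] at hB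
      exact absurd (by rw [hB.2]; simp) hU
  · rcases B with _ | ⟨x, B⟩
    · simpa [eq_comm] using hB
    · simp only [List.cons_append, List.cons.injEq] at hB
      exact absurd (by rw [hB.2]; simp) hU'

lemma exists_eq_append_cons_notMem {M : ℕ} {Q : List ℕ} (h : M ∈ Q) :
    ∃ A U, Q = A ++ M :: U ∧ M ∉ U := by
  obtain ⟨as, bs, hQ, has⟩ := List.eq_append_cons_of_mem (List.mem_reverse.2 h)
  refine ⟨bs.reverse, as.reverse, ?_, by simpa using has⟩
  rw [← List.reverse_reverse Q, hQ]
  simp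

/-- The string `M g(1) M g(2) ⋯ M g(y)`. -/
def blockWord (M : ℕ) (g : ℕ → List ℕ) : ℕ → List ℕ
  | 0 => []
  | y + 1 => blockWord M g y ++ M :: g (y + 1)

section blockWord

variable {M : ℕ} {g g' : ℕ → List ℕ}

lemma blockWord_congr {y : ℕ} (h : ∀ i, 1 ≤ i → i ≤ y → g i = g' i) :
    blockWord M g y = blockWord M g' y := by
  induction y with
  | zero => rfl
  | succ y ih =>
    rw [blockWord, blockWord, ih fun i h1 h2 => h i h1 (by omega), h (y + 1) (by omega) le_rfl]

lemma blockWord_add (a n : ℕ) :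
    blockWord M g (a + n) = blockWord M g a ++ blockWord M (fun i => g (a + i)) n := by
  induction n with
  | zero => simp [blockWord]
  | succ n ih => rw [← add_assoc, blockWord, ih, blockWord]; simp [add_assoc]

lemma blockWord_mono {x y : ℕ} (h : x ≤ y) : blockWord M g x <+: blockWord M g y := by
  obtain ⟨n, rfl⟩ := Nat.exists_eq_add_of_le h
  exact ⟨_, (blockWord_add x n).symm⟩

lemma count_blockWord (hg : ∀ i, M ∉ g i) (y : ℕ) : (blockWord M g y).count M = y := by
  induction y with
  | zero => rfl
  | succ y ih => simp [blockWord, ih, List.count_eq_zero_of_not_mem (hg _)]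

lemma strictMono_length_blockWord : StrictMono fun y => (blockWord M g y).length :=
  strictMono_nat_of_lt_succ fun y => by simp [blockWord]

lemma prefix_blockWord {P : List ℕ} {y : ℕ} (h : P <+: blockWord M g y) :
    P = [] ∨ ∃ c U, c < y ∧ U <+: g (c + 1) ∧ P = blockWord M g c ++ M :: U := by
  induction y with
  | zero => exact .inl (List.prefix_nil.1 h)
  | succ y ih =>
    have main : P <+: blockWord M g y →
        P = [] ∨ ∃ c U, c < y + 1 ∧ U <+: g (c + 1) ∧ P = blockWord M g c ++ M :: U := by
      intro h'
      rcases ih h' with h' | ⟨c, U, hc, hU⟩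
      · exact .inl h'
      · exact .inr ⟨c, U, by omega, hU⟩
    rw [blockWord] at h
    rcases List.prefix_or_prefix_of_prefix h (List.prefix_append _ _) with h' | ⟨R, rfl⟩
    · exact main h'
    · rw [List.prefix_append_right_inj, List.prefix_cons_iff] at h
      rcases h with rfl | ⟨U, rfl, hU⟩
      · exact main (by simp)
      · exact .inr ⟨y, U, by omega, hU, rfl⟩

lemma exists_of_suffix_blockWord (hg : ∀ i, M ∉ g i) {Q : List ℕ} {a : ℕ}
    (h : Q <:+ blockWord M g a) (hQ : M ∈ Q) :
    ∃ a₀ Q₀, a = a₀ + 1 ∧ Q = Q₀ ++ M :: g a ∧ Q₀ <:+ blockWord M g a₀ := by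
  obtain ⟨A, U, rfl, hU⟩ := exists_eq_append_cons_notMem hQ
  obtain ⟨X, hX⟩ := h
  rcases a with _ | a
  · simp [blockWord] at hX
  · rw [blockWord, ← List.append_assoc] at hX
    obtain ⟨h1, h2⟩ := append_cons_inj_of_notMem_right hU (hg _) hX
    exact ⟨a, A, rfl, by rw [h2], X, h1⟩

/-- A common suffix of two block words with `N` separators forces agreement of the last `N`
blocks. -/
lemma blocks_eq_of_suffix (hg : ∀ i, M ∉ g i) (hg' : ∀ i, M ∉ g' i) {Q : List ℕ} {a a' N : ℕ}
    (h : Q <:+ blockWord M g a) (h' : Q <:+ blockWord M g' a') (hN : N ≤ Q.count M) {j : ℕ}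
    (hj : j < N) : g (a - j) = g' (a' - j) := by
  have hQ : M ∈ Q := List.count_pos_iff.1 (by omega)
  obtain ⟨b, R, rfl, hR, hRs⟩ := exists_of_suffix_blockWord hg h hQ
  obtain ⟨b', R', rfl, hR', hRs'⟩ := exists_of_suffix_blockWord hg' h' hQ
  obtain ⟨rfl, h2⟩ := append_cons_inj_of_notMem_right (hg _) (hg' _) (hR.symm.trans hR')
  induction j generalizing Q b b' N R with
  | zero => exact h2
  | succ j ih =>
    have hc : N - 1 ≤ R.count M := by
      rw [hR] at hN
      simp [List.count_eq_zero_of_not_mem (hg _)] at hN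
      omega
    have hQ : M ∈ R := List.count_pos_iff.1 (by omega)
    obtain ⟨c, S, rfl, hS, hSs⟩ := exists_of_suffix_blockWord hg hRs hQ
    obtain ⟨c', S', rfl, hS', hSs'⟩ := exists_of_suffix_blockWord hg' hRs' hQ
    obtain ⟨rfl, h3⟩ := append_cons_inj_of_notMem_right (hg _) (hg' _) (hS.symm.trans hS')
    simpa using ih hc (by omega) hQ c S hRs hS hSs c' hRs' h3 hS' hSs'

/-- If a block word ends in a power of a string containing the separator, then its sequence of
blocks is periodic near the end. -/
lemma blocks_periodic_of_eq_append_pow (hg : ∀ i, M ∉ g i) {y k : ℕ} {X Y : List ℕ}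
    (hY : M ∈ Y) (hk : 2 ≤ k)
    (h : blockWord M g y = X ++ (List.replicate k Y).flatten) :
    ∃ d, 1 ≤ d ∧ k * d ≤ y ∧ g y <+: g (y - d) ∧
      ∀ i, y + d < i + k * d → i < y → g i = g (i - d) := by
  have hd : 1 ≤ Y.count M := List.count_pos_iff.2 hY
  obtain ⟨k, rfl⟩ : ∃ l, k = l + 1 := ⟨k - 1, by omega⟩
  set d := Y.count M with hddef
  set Q := (List.replicate k Y).flatten with hQ
  have hQc : Q.count M = k * d := by
    simp [hQ, List.count_flatten, List.map_replicate, List.sum_replicate]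
    exact .inl rfl
  have h1 : blockWord M g y = (X ++ Q) ++ Y := by
    rw [h, List.replicate_succ', List.flatten_append]
    simp [hQ]
  have h1' : blockWord M g y = (X ++ Y) ++ Q := by
    rw [h, List.replicate_succ, List.flatten_cons]
    simp [hQ]
  have hcy : y = X.count M + k * d + d := by
    rw [← count_blockWord hg y, h1, List.count_append, List.count_append, hQc]
  have hkd : 0 < k * d := Nat.mul_pos (by omega) hd
  rcases prefix_blockWord ⟨Y, h1.symm⟩ with h2 | ⟨c, U, hc, hU, h2⟩
  · have := congrArg (List.count M) h2
    rw [List.count_append, hQc] at this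
    simp at this
    omega
  have hMU : M ∉ U := fun hm => hg _ (hU.subset hm)
  have hcc : c + 1 = y - d := by
    have := congrArg (List.count M) h2
    rw [List.count_append, hQc, List.count_append, count_blockWord hg, List.count_cons_self,
      List.count_eq_zero_of_not_mem hMU] at this
    omega
  set g' := Function.update g (c + 1) U with hg'def
  have hg' : ∀ i, M ∉ g' i := by
    intro i
    rcases eq_or_ne i (c + 1) with rfl | hi
    · simpa [hg'def]
    · simpa [hg'def, hi] using hg i
  have h3 : X ++ Q = blockWord M g' (c + 1) := by
    rw [h2, blockWord]
    congr 1
    · exact blockWord_congr fun i _ hi => by rw [hg'def, Function.update_of_ne (by omega)]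
    · simp [hg'def]
  have key : ∀ j, j < k * d → g (y - j) = g' (c + 1 - j) := fun j hj =>
    blocks_eq_of_suffix hg hg' ⟨_, h1'.symm⟩ ⟨_, h3⟩ hQc.ge hj
  refine ⟨d, hd, by rw [add_mul]; omega, ?_, fun i hi hiy => ?_⟩
  · have := key 0 hkd
    simp only [Nat.sub_zero, hg'def, Function.update_self] at this
    rwa [this, ← hcc]
  · have := key (y - i) (by rw [add_mul] at hi; omega)
    rw [hg'def, Function.update_of_ne (by omega)] at this
    convert this using 2 <;> omega

lemma blockWord_mul {d k : ℕ} (h : ∀ i, 1 ≤ i → i + d ≤ k * d → g (i + d) = g i) :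
    blockWord M g (k * d) = (List.replicate k (blockWord M g d)).flatten := by
  induction k with
  | zero => simp [blockWord]
  | succ k ih =>
    rw [add_mul, one_mul, add_comm, blockWord_add, List.replicate_succ, List.flatten_cons,
      ← ih fun i h1 h2 => h i h1 (by rw [add_mul]; omega)]
    congr 1
    exact blockWord_congr fun i h1 h2 => by
      rw [add_comm d i, h i h1 (by rw [add_mul]; omega)]

lemma endsInPow_blockWord {y d k : ℕ} (hd : 1 ≤ d) (hk : k * d ≤ y)
    (h : ∀ i, y + d < i + k * d → i ≤ y → g i = g (i - d)) : EndsInPow (blockWord M g y) k := by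
  obtain ⟨a, rfl⟩ := Nat.exists_eq_add_of_le' hk
  refine ⟨blockWord M g a, blockWord M (fun i => g (a + i)) d, ?_, ?_⟩
  · obtain ⟨d, rfl⟩ : ∃ e, d = e + 1 := ⟨d - 1, by omega⟩
    simp [blockWord]
  · rw [blockWord_add, blockWord_mul]
    intro i h1 h2
    rw [h (a + (i + d)) (by omega) (by omega)]
    congr 1
    omega

/-- Powers at the end of a block word with period free of the separator lie in the last block. -/
lemma endsInPow_last_of_notMem {k : ℕ} {X Y A U : List ℕ} (hY : Y ≠ []) (hMY : M ∉ Y)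
    (h : A ++ M :: U = X ++ (List.replicate k Y).flatten) : EndsInPow U k := by
  have h1 : (List.replicate k Y).flatten <:+ A ++ M :: U := ⟨X, h.symm⟩
  have h2 : M ∉ (List.replicate k Y).flatten := by
    simp only [List.mem_flatten, List.mem_replicate]
    rintro ⟨l, ⟨_, rfl⟩, hl⟩
    exact hMY hl
  rcases List.suffix_or_suffix_of_suffix h1 (List.suffix_append A (M :: U)) with h3 | h3
  · rcases List.suffix_cons_iff.1 h3 with h3 | ⟨Z, hZ⟩
    · exact absurd (by rw [h3]; simp) h2
    · exact ⟨Z, Y, hY, hZ.symm⟩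
  · exact absurd (h3.subset (by simp)) h2

end blockWord

section multiplicity

variable {b : ℕ}

lemma pow_dvd_iff_le_mult (hb : 2 ≤ b) {i : ℕ} (hi : 0 < i) (s : ℕ) :
    b ^ s ∣ i ↔ s ≤ multiplicity b i :=
  (Nat.finiteMultiplicity_iff.2 ⟨by omega, hi⟩).pow_dvd_iff_le_multiplicity

lemma mult_eq_iff (hb : 2 ≤ b) {i : ℕ} (hi : 0 < i) (s : ℕ) :
    multiplicity b i = s ↔ b ^ s ∣ i ∧ ¬ b ^ (s + 1) ∣ i := by
  rw [pow_dvd_iff_le_mult hb hi, pow_dvd_iff_le_mult hb hi]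
  omega

lemma mult_sub_pow (hb : 2 ≤ b) {s i : ℕ} (hi : b ^ s < i) (h1 : ¬ b ^ (s + 1) ∣ i)
    (h2 : ¬ b ^ (s + 1) ∣ i - b ^ s) : multiplicity b i = multiplicity b (i - b ^ s) := by
  have key : ∀ e, e ≤ multiplicity b i ↔ e ≤ multiplicity b (i - b ^ s) := by
    intro e
    rw [← pow_dvd_iff_le_mult hb (by omega), ← pow_dvd_iff_le_mult hb (by omega)]
    rcases le_or_gt e s with he | he
    · rw [Nat.dvd_sub_iff_left hi.le (pow_dvd_pow b he)]
    · exact ⟨fun h => absurd ((pow_dvd_pow b he).trans h) h1,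
        fun h => absurd ((pow_dvd_pow b he).trans h) h2⟩
  exact le_antisymm ((key _).1 le_rfl) ((key _).2 le_rfl)

/-- Three or more periods of the ruler sequence contain no multiple of the next power of `b`. -/
lemma not_dvd_of_mult_periodic (hb : 2 ≤ b) {y d k : ℕ} (hd : 1 ≤ d) (hk : 3 ≤ k)
    (hkd : k * d ≤ y)
    (h : ∀ i, y + d < i + k * d → i < y → multiplicity b i = multiplicity b (i - d)) :
    ∃ s, b ^ s ∣ d ∧ ¬ b ^ (s + 1) ∣ d ∧ ∀ i, y < i + k * d → i < y → ¬ b ^ (s + 1) ∣ i := by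
  have hk3 : 3 * d ≤ k * d := Nat.mul_le_mul_right _ hk
  obtain ⟨hs1, hs2⟩ := (mult_eq_iff hb hd _).1 rfl
  refine ⟨multiplicity b d, hs1, hs2, fun i hi hiy hdvd => hs2 ?_⟩
  rcases lt_or_ge (i + d) y with hid | hid
  · have h1 := h (i + d) (by omega) hid
    rw [Nat.add_sub_cancel] at h1
    rw [pow_dvd_iff_le_mult hb (by omega), ← h1, ← pow_dvd_iff_le_mult hb (by omega)] at hdvd
    have hdvd' : b ^ (multiplicity b d + 1) ∣ i := by
      rwa [pow_dvd_iff_le_mult hb (by omega), ← h1, ← pow_dvd_iff_le_mult hb (by omega)]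
    exact (Nat.dvd_add_right hdvd').1 hdvd
  · have h1 := h i (by omega) hiy
    have hdvd' : b ^ (multiplicity b d + 1) ∣ i - d := by
      rwa [pow_dvd_iff_le_mult hb (by omega), ← h1, ← pow_dvd_iff_le_mult hb (by omega)]
    have h2 := Nat.dvd_sub hdvd hdvd'
    rwa [Nat.sub_sub_self (by omega)] at h2

lemma le_base_of_mult_periodic (hb : 2 ≤ b) {y d k : ℕ} (hd : 1 ≤ d) (hk : 3 ≤ k)
    (hkd : k * d ≤ y)
    (h : ∀ i, y + d < i + k * d → i < y → multiplicity b i = multiplicity b (i - d)) :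
    k ≤ b := by
  obtain ⟨s, hs1, -, hs⟩ := not_dvd_of_mult_periodic hb hd hk hkd h
  by_contra! hkb
  have hk3 : 3 * d ≤ k * d := Nat.mul_le_mul_right _ hk
  have h1 : b ^ s ≤ d := Nat.le_of_dvd hd hs1
  have h2 : (b + 1) * b ^ s ≤ k * d := Nat.mul_le_mul hkb h1
  have h3 : 0 < b ^ s := by positivity
  have h4 : (y - 1) % b ^ (s + 1) < b ^ (s + 1) := Nat.mod_lt _ (by positivity)
  have h5 := Nat.div_add_mod (y - 1) (b ^ (s + 1))
  have h6 : b ^ (s + 1) = b * b ^ s := pow_succ' b s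
  rw [add_mul, one_mul] at h2
  generalize (y - 1) % b ^ (s + 1) = r at h4 h5
  exact hs (b ^ (s + 1) * ((y - 1) / b ^ (s + 1))) (by omega) (by omega) (dvd_mul_right _ _)

lemma exists_le_digit_of_mult_periodic (hb : 2 ≤ b) {y d k : ℕ} (hd : 1 ≤ d) (hk : 3 ≤ k)
    (hkd : k * d ≤ y)
    (h : ∀ i, y + d < i + k * d → i < y → multiplicity b i = multiplicity b (i - d))
    (hy : multiplicity b y ≤ multiplicity b (y - d)) : ∃ s, k ≤ y / b ^ s % b := by
  have hk3 : 3 * d ≤ k * d := Nat.mul_le_mul_right _ hk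
  obtain ⟨s, hs1, hs2, hs⟩ := not_dvd_of_mult_periodic hb hd hk hkd h
  have hyd : ¬ b ^ (s + 1) ∣ y := by
    intro hdvd
    have h1 : b ^ (s + 1) ∣ y - d := by
      rw [pow_dvd_iff_le_mult hb (by omega)] at hdvd ⊢
      exact hdvd.trans hy
    have h2 := Nat.dvd_sub hdvd h1
    rw [Nat.sub_sub_self (by omega)] at h2
    exact hs2 h2
  have h5 := Nat.div_add_mod y (b ^ (s + 1))
  have h6 : 0 < y % b ^ (s + 1) := Nat.pos_of_ne_zero fun h0 => hyd (Nat.dvd_of_mod_eq_zero h0)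
  have h7 : k * d ≤ y % b ^ (s + 1) := by
    by_contra! hlt
    exact hs (b ^ (s + 1) * (y / b ^ (s + 1))) (by omega) (by omega) (dvd_mul_right _ _)
  refine ⟨s, ?_⟩
  rw [← Nat.mod_mul_right_div_self, ← pow_succ, Nat.le_div_iff_mul_le (by positivity)]
  exact (Nat.mul_le_mul_left k (Nat.le_of_dvd hd hs1)).trans h7

lemma mult_periodic_of_le_digit (hb : 2 ≤ b) {y k s : ℕ} (h : k ≤ y / b ^ s % b) :
    k * b ^ s ≤ y ∧ ∀ i, y + b ^ s < i + k * b ^ s → i ≤ y →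
      multiplicity b i = multiplicity b (i - b ^ s) := by
  rw [← Nat.mod_mul_right_div_self, ← pow_succ, Nat.le_div_iff_mul_le (by positivity)] at h
  have hle := Nat.mod_le y (b ^ (s + 1))
  have h5 := Nat.div_add_mod y (b ^ (s + 1))
  have hnd : ∀ i, y < i + k * b ^ s → i ≤ y → ¬ b ^ (s + 1) ∣ i := by
    rintro i hi hiy ⟨c, rfl⟩
    have hc : c ≤ y / b ^ (s + 1) := by
      rw [Nat.le_div_iff_mul_le (by positivity), mul_comm]
      exact hiy
    have := Nat.mul_le_mul_left (b ^ (s + 1)) hc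
    omega
  refine ⟨h.trans hle, fun i hi hiy => mult_sub_pow hb (by omega) ?_ ?_⟩
  · exact hnd i (by omega) hiy
  · exact hnd _ (by omega) (by omega)

lemma mult_periodic_of_dvd (hb : 2 ≤ b) {y s : ℕ} (hy : b ^ (s + 1) ∣ y) {i : ℕ}
    (hi : y + b ^ s < i + b * b ^ s) (hiy : i < y) :
    multiplicity b i = multiplicity b (i - b ^ s) := by
  have hp : 0 < b ^ s := by positivity
  have hnd : ∀ i, y < i + b * b ^ s → i < y → ¬ b ^ (s + 1) ∣ i := by
    intro i hi hiy hdvd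
    have := Nat.le_of_dvd (by omega) (Nat.dvd_sub hy hdvd)
    rw [pow_succ'] at this
    omega
  have hy' := Nat.le_of_dvd (by omega) hy
  rw [pow_succ'] at hy'
  exact mult_sub_pow hb (by omega) (hnd i (by omega) hiy) (hnd _ (by omega) (by omega))

lemma mult_sub_pow_of_dvd (hb : 2 ≤ b) {y s : ℕ} (hy0 : 0 < y) (hy : b ^ (s + 1) ∣ y) :
    multiplicity b (y - b ^ s) = s := by
  have hp : 0 < b ^ s := by positivity
  have hlt : b ^ s < b ^ (s + 1) := Nat.pow_lt_pow_right (by omega) (by omega)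
  have hy' := Nat.le_of_dvd hy0 hy
  rw [mult_eq_iff hb (by omega)]
  refine ⟨Nat.dvd_sub ((pow_dvd_pow b (by omega)).trans hy) dvd_rfl, fun h => ?_⟩
  have h2 := Nat.dvd_sub hy h
  rw [Nat.sub_sub_self (by omega)] at h2
  exact absurd (Nat.le_of_dvd hp h2) (by omega)

end multiplicity

section gPrefix

lemma length_gPrefix (m n : ℕ) : (gPrefix m n).length = n := by
  induction n with
  | zero => rfl
  | succ n ih => simp [gPrefix, ih]

lemma gPrefix_mono (m : ℕ) {a c : ℕ} (h : a ≤ c) : gPrefix m a <+: gPrefix m c := by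
  induction c, h using Nat.le_induction with
  | base => exact List.prefix_rfl
  | succ n _ ih => exact ih.trans (List.prefix_append _ _)

lemma eq_gPrefix_of_isPrefix {m n : ℕ} {U : List ℕ} (h : U <+: gPrefix m n) :
    U = gPrefix m U.length :=
  List.IsPrefix.eq_of_length
    (List.prefix_of_prefix_length_le h
      (gPrefix_mono m (by simpa [length_gPrefix] using h.length_le)) (by rw [length_gPrefix]))
    (by rw [length_gPrefix])

lemma le_of_mem_gPrefix {m n x : ℕ} (h : x ∈ gPrefix m n) : m ≤ x := by
  induction n with
  | zero => simp [gPrefix] at h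
  | succ n ih =>
    rcases List.mem_append.1 h with h | h
    · exact ih h
    · rw [List.mem_singleton.1 h]
      exact le_max_left _ _

lemma length_Tstr (m t : ℕ) : (Tstr m t).length = tau m t := length_gPrefix _ _

lemma notMem_Tstr (m t : ℕ) : m ∉ Tstr m t := fun h => by
  have := le_of_mem_gPrefix h
  omega

end gPrefix

section structure_theorem

variable {M : ℕ}

lemma strictMono_tau (hT : {k | curl (gPrefix (M + 1) k) ≤ M}.Infinite) :
    StrictMono fun t => tau M (t + 1) :=
  Nat.nth_strictMono hT

lemma curl_Tstr_le (hT : {k | curl (gPrefix (M + 1) k) ≤ M}.Infinite) (t : ℕ) :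
    curl (Tstr M t) ≤ M :=
  Nat.nth_mem_of_infinite hT (t - 1)

lemma exists_eq_Tstr {k : ℕ} (hk : curl (gPrefix (M + 1) k) ≤ M) :
    ∃ s, gPrefix (M + 1) k = Tstr M (s + 1) :=
  ⟨Nat.count (fun k => curl (gPrefix (M + 1) k) ≤ M) k, by
    rw [Tstr, tau, Nat.add_sub_cancel,
      Nat.nth_count (p := fun k => curl (gPrefix (M + 1) k) ≤ M) hk]⟩

lemma Tstr_succ_injective (hT : {k | curl (gPrefix (M + 1) k) ≤ M}.Infinite) {s t : ℕ}
    (h : Tstr M (s + 1) = Tstr M (t + 1)) : s = t := by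
  apply (strictMono_tau hT).injective
  simpa [length_Tstr] using congrArg List.length h

lemma le_of_Tstr_isPrefix (hT : {k | curl (gPrefix (M + 1) k) ≤ M}.Infinite) {s t : ℕ}
    (h : Tstr M (s + 1) <+: Tstr M (t + 1)) : s ≤ t := by
  apply (strictMono_tau hT).le_iff_le.1
  simpa [length_Tstr] using h.length_le

/-- The string following the `i`-th occurrence of `M` in `A^(M)`. -/
noncomputable def rulerBlock (M i : ℕ) : List ℕ := Tstr M (multiplicity (M + 1) i + 1)

lemma notMem_rulerBlock (M i : ℕ) : M ∉ rulerBlock M i := notMem_Tstr _ _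

lemma rulerBlock_eq (hT : {k | curl (gPrefix (M + 1) k) ≤ M}.Infinite) {i j : ℕ} :
    rulerBlock M i = rulerBlock M j ↔ multiplicity (M + 1) i = multiplicity (M + 1) j :=
  ⟨Tstr_succ_injective hT, fun h => by rw [rulerBlock, rulerBlock, h]⟩

lemma endsInPow_partial_le (hT : {k | curl (gPrefix (M + 1) k) ≤ M}.Infinite) (hM : 2 ≤ M)
    {y k : ℕ} {U : List ℕ} (hU : M ∉ U)
    (h : EndsInPow (blockWord M (rulerBlock M) y ++ M :: U) k) : k ≤ max (M + 1) (curl U) := by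
  rcases Nat.lt_or_ge k 3 with hk | hk
  · exact le_max_of_le_left (by omega)
  obtain ⟨X, Y, hY, hS⟩ := h
  by_cases hMY : M ∈ Y
  · refine le_max_of_le_left ?_
    set g := Function.update (rulerBlock M) (y + 1) U with hg
    have hgM : ∀ i, M ∉ g i := by
      intro i
      rcases eq_or_ne i (y + 1) with rfl | hi
      · simpa [hg]
      · simpa [hg, hi] using notMem_rulerBlock M i
    have h1 : blockWord M (rulerBlock M) y ++ M :: U = blockWord M g (y + 1) := by
      rw [blockWord]
      congr 1
      · exact blockWord_congr fun i _ hi => by rw [hg, Function.update_of_ne (by omega)]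
      · simp [hg]
    rw [h1] at hS
    obtain ⟨d, hd, hkd, -, hper⟩ := blocks_periodic_of_eq_append_pow hgM hMY (by omega) hS
    refine le_base_of_mult_periodic (y := y + 1) (by omega) hd hk hkd fun i hi hiy => ?_
    have := hper i hi hiy
    rw [hg, Function.update_of_ne (by omega), Function.update_of_ne (by omega)] at this
    exact (rulerBlock_eq hT).1 this
  · exact le_max_of_le_right (endsInPow_last_of_notMem hY hMY hS).le_curl

lemma curl_blockWord_le_iff (hT : {k | curl (gPrefix (M + 1) k) ≤ M}.Infinite) (hM : 2 ≤ M)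
    {y K : ℕ} (hy : 1 ≤ y) (hK : 2 ≤ K) :
    curl (blockWord M (rulerBlock M) y) ≤ K ↔
      curl (rulerBlock M y) ≤ K ∧ ∀ s, y / (M + 1) ^ s % (M + 1) ≤ K := by
  have hlast : ∃ A, blockWord M (rulerBlock M) y = A ++ M :: rulerBlock M y := by
    obtain ⟨x, rfl⟩ : ∃ x, y = x + 1 := ⟨y - 1, by omega⟩
    exact ⟨_, rfl⟩
  constructor
  · intro h
    constructor
    · obtain ⟨A, hA⟩ := hlast
      rw [hA, List.append_cons] at h
      exact (curl_le_curl_append _ _).trans h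
    · intro s
      obtain ⟨h1, h2⟩ := mult_periodic_of_le_digit (b := M + 1) (y := y) (s := s) (by omega) le_rfl
      refine (endsInPow_blockWord (d := (M + 1) ^ s) (Nat.one_le_pow _ _ (by omega)) h1
        fun i hi hiy => ?_).le_curl.trans h
      rw [rulerBlock_eq hT]
      exact h2 i hi hiy
  · rintro ⟨h1, h2⟩
    rw [curl_le_iff (by omega)]
    intro k hk
    rcases Nat.lt_or_ge k 3 with hk3 | hk3
    · omega
    obtain ⟨X, Y, hY, hS⟩ := hk
    by_cases hMY : M ∈ Y
    · obtain ⟨d, hd, hkd, hpre, hper⟩ :=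
        blocks_periodic_of_eq_append_pow (notMem_rulerBlock M) hMY (by omega) hS
      obtain ⟨s, hs⟩ := exists_le_digit_of_mult_periodic (b := M + 1) (by omega) hd hk3 hkd
        (fun i hi hiy => (rulerBlock_eq hT).1 (hper i hi hiy)) (le_of_Tstr_isPrefix hT hpre)
      exact hs.trans (h2 s)
    · obtain ⟨A, hA⟩ := hlast
      rw [hA] at hS
      exact (endsInPow_last_of_notMem hY hMY hS).le_curl.trans h1

lemma curl_blockWord_le (hT : {k | curl (gPrefix (M + 1) k) ≤ M}.Infinite) (hM : 2 ≤ M) (y : ℕ) :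
    curl (blockWord M (rulerBlock M) y) ≤ M := by
  rcases Nat.eq_zero_or_pos y with rfl | hy
  · rw [blockWord, curl_nil]
    omega
  · rw [curl_blockWord_le_iff hT hM hy hM]
    exact ⟨curl_Tstr_le hT _, fun s => Nat.lt_succ_iff.1 (Nat.mod_lt _ (by omega))⟩

/-- Inside a block, the curling number is the one seen by `A^(M+1)`. -/
lemma curl_partial (hT : {k | curl (gPrefix (M + 1) k) ≤ M}.Infinite) (hM : 2 ≤ M) {y : ℕ}
    {U : List ℕ} (hU : U <+: rulerBlock M (y + 1)) (hne : U ≠ rulerBlock M (y + 1)) :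
    curl (blockWord M (rulerBlock M) y ++ M :: U) = max (M + 1) (curl U) := by
  have hMU : M ∉ U := fun h => notMem_rulerBlock M _ (hU.subset h)
  have hge : curl U ≤ curl (blockWord M (rulerBlock M) y ++ M :: U) := by
    rw [List.append_cons]
    exact curl_le_curl_append _ _
  refine le_antisymm ?_ (max_le ?_ hge)
  · rw [curl_le_iff (le_max_of_le_left (by omega))]
    exact fun k hk => endsInPow_partial_le hT hM hMU hk
  · by_cases hcU : M + 1 ≤ curl U
    · exact hcU.trans hge
    · have hUeq := eq_gPrefix_of_isPrefix hU
      rw [hUeq] at hcU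
      obtain ⟨s, hs⟩ := exists_eq_Tstr (M := M) (k := U.length) (by omega)
      rw [← hUeq] at hs
      subst hs
      have hsle := le_of_Tstr_isPrefix hT hU
      have hslt : s < multiplicity (M + 1) (y + 1) :=
        lt_of_le_of_ne hsle fun h => hne (by rw [rulerBlock, ← h])
      have hdvd : (M + 1) ^ (s + 1) ∣ y + 1 :=
        (pow_dvd_iff_le_mult (by omega) (by omega) _).2 hslt
      have hle := Nat.le_of_dvd (by omega) hdvd
      rw [pow_succ'] at hle
      set g := Function.update (rulerBlock M) (y + 1) (Tstr M (s + 1)) with hg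
      have h1 : blockWord M (rulerBlock M) y ++ M :: Tstr M (s + 1) = blockWord M g (y + 1) := by
        rw [blockWord]
        congr 1
        · exact blockWord_congr fun i _ hi => by rw [hg, Function.update_of_ne (by omega)]
        · simp [hg]
      have hpos : 0 < (M + 1) ^ s := by positivity
      rw [h1]
      refine (endsInPow_blockWord (d := (M + 1) ^ s) hpos hle fun i hi hiy => ?_).le_curl
      rcases hiy.eq_or_lt with rfl | hiy
      · rw [hg, Function.update_self, Function.update_of_ne (by omega), rulerBlock,
          mult_sub_pow_of_dvd (by omega) (by omega) hdvd]
      · rw [hg, Function.update_of_ne (by omega), Function.update_of_ne (by omega),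
          rulerBlock_eq hT]
        exact mult_periodic_of_dvd (by omega) hdvd hi hiy

/-- `A^(M)` is the concatenation of the blocks `M · T_{v(i)+1}`, where `v` is the
`(M+1)`-adic valuation. -/
theorem gPrefix_length_blockWord (hT : {k | curl (gPrefix (M + 1) k) ≤ M}.Infinite) (hM : 2 ≤ M)
    (y : ℕ) : gPrefix M (blockWord M (rulerBlock M) y).length = blockWord M (rulerBlock M) y := by
  induction y with
  | zero => rfl
  | succ y ih =>
    have key : ∀ n, n ≤ (rulerBlock M (y + 1)).length →
        gPrefix M ((blockWord M (rulerBlock M) y).length + 1 + n) =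
          blockWord M (rulerBlock M) y ++ M :: (rulerBlock M (y + 1)).take n := by
      intro n hn
      induction n with
      | zero =>
        rw [Nat.add_zero, gPrefix, ih, max_eq_left (curl_blockWord_le hT hM y), List.take_zero]
      | succ n ihn =>
        have hpre : (rulerBlock M (y + 1)).take (n + 1) <+: rulerBlock M (y + 1) :=
          ⟨_, List.take_append_drop _ _⟩
        have hpre' : (rulerBlock M (y + 1)).take n <+: rulerBlock M (y + 1) :=
          ⟨_, List.take_append_drop _ _⟩
        have hne : (rulerBlock M (y + 1)).take n ≠ rulerBlock M (y + 1) := by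
          intro h
          have := congrArg List.length h
          rw [List.length_take] at this
          omega
        have h1 : (rulerBlock M (y + 1)).take n = gPrefix (M + 1) n := by
          have := eq_gPrefix_of_isPrefix hpre'
          rwa [List.length_take, min_eq_left (by omega)] at this
        have h2 : (rulerBlock M (y + 1)).take (n + 1) = gPrefix (M + 1) (n + 1) := by
          have := eq_gPrefix_of_isPrefix hpre
          rwa [List.length_take, min_eq_left (by omega)] at this
        rw [← add_assoc, gPrefix, ihn (by omega), curl_partial hT hM hpre' hne, h2, gPrefix, ← h1,
          max_eq_right (le_max_of_le_left (by omega))]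
        simp
    have := key _ le_rfl
    rw [List.take_length] at this
    rw [blockWord, ← this, length_gPrefix]

lemma gPrefix_eq_partial (hT : {k | curl (gPrefix (M + 1) k) ≤ M}.Infinite) (hM : 2 ≤ M) {n : ℕ}
    (hn : 0 < n) : ∃ y U, U <+: rulerBlock M (y + 1) ∧
      gPrefix M n = blockWord M (rulerBlock M) y ++ M :: U := by
  have h1 : n ≤ (blockWord M (rulerBlock M) n).length :=
    strictMono_length_blockWord.le_apply
  have h2 := gPrefix_mono M h1
  rw [gPrefix_length_blockWord hT hM] at h2
  rcases prefix_blockWord h2 with h | ⟨c, U, -, hU, h⟩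
  · have := congrArg List.length h
    rw [length_gPrefix, List.length_nil] at this
    omega
  · exact ⟨c, U, hU, h⟩

lemma exists_length_blockWord_of_curl_le (hT : {k | curl (gPrefix (M + 1) k) ≤ M}.Infinite)
    (hM : 2 ≤ M) {n : ℕ} (hn : curl (gPrefix M n) ≤ M) :
    ∃ y, (blockWord M (rulerBlock M) y).length = n := by
  rcases Nat.eq_zero_or_pos n with rfl | hpos
  · exact ⟨0, rfl⟩
  obtain ⟨y, U, hU, h⟩ := gPrefix_eq_partial hT hM hpos
  by_cases hne : U = rulerBlock M (y + 1)
  · subst hne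
    exact ⟨y + 1, by rw [blockWord, ← h, length_gPrefix]⟩
  · rw [h, curl_partial hT hM hU hne] at hn
    have := le_max_left (M + 1) (curl U)
    omega

end structure_theorem

section chi

variable {b : ℕ}

lemma chi_eq (hb : 2 ≤ b) (a : ℕ) : chi b a = a % b + (b + 1) * chi b (a / b) := by
  rcases Nat.eq_zero_or_pos a with rfl | ha
  · simp [chi]
  · rw [chi, chi, Nat.digits_def' (by omega) ha, Nat.ofDigits_cons]

lemma strictMono_chi (hb : 2 ≤ b) : StrictMono (chi b) := by
  intro a c hac
  induction c using Nat.strong_induction_on generalizing a with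
  | _ c ih =>
    rw [chi_eq hb a, chi_eq hb c]
    have ha := Nat.div_add_mod a b
    have hc := Nat.div_add_mod c b
    have hr : a % b < b := Nat.mod_lt _ (by omega)
    rcases (Nat.div_le_div_right hac.le : a / b ≤ c / b).eq_or_lt with h | h
    · rw [h] at ha ⊢
      omega
    · have h1 := ih (c / b) (Nat.div_lt_self (by omega) (by omega)) h
      have h2 := Nat.mul_le_mul_left (b + 1) h1
      rw [Nat.succ_eq_add_one, mul_add, mul_one] at h2
      omega

lemma digits_chi (hb : 2 ≤ b) (a : ℕ) : Nat.digits (b + 1) (chi b a) = Nat.digits b a :=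
  Nat.digits_ofDigits _ (by omega) _
    (fun l hl => (Nat.digits_lt_base (by omega) hl).trans (by omega))
    fun h => Nat.getLast_digit_ne_zero b (Nat.digits_ne_nil_iff_ne_zero.1 h)

lemma chi_digit (hb : 2 ≤ b) (a s : ℕ) : chi b a / (b + 1) ^ s % (b + 1) = a / b ^ s % b := by
  rw [← Nat.getD_digits _ _ hb, ← digits_chi hb, Nat.getD_digits _ _ (by omega)]

lemma exists_chi_eq (hb : 2 ≤ b) {y : ℕ} (hy : ∀ s, y / (b + 1) ^ s % (b + 1) < b) :
    ∃ a, chi b a = y := by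
  refine ⟨Nat.ofDigits b (Nat.digits (b + 1) y), ?_⟩
  rw [chi, Nat.digits_ofDigits b (by omega), Nat.ofDigits_digits]
  · intro l hl
    obtain ⟨i, hi, rfl⟩ := List.getElem_of_mem hl
    have := hy i
    rwa [← Nat.getD_digits _ _ (by omega), List.getD_eq_getElem _ _ hi] at this
  · exact fun h => Nat.getLast_digit_ne_zero _ (Nat.digits_ne_nil_iff_ne_zero.1 h)

lemma pow_dvd_iff_digits (hb : 2 ≤ b) (a s : ℕ) :
    b ^ s ∣ a ↔ ∀ e < s, a / b ^ e % b = 0 := by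
  induction s with
  | zero => simp
  | succ s ih =>
    rw [Nat.forall_lt_succ_right, ← ih]
    constructor
    · rintro ⟨c, rfl⟩
      refine ⟨⟨b * c, by ring⟩, ?_⟩
      rw [pow_succ, mul_assoc, Nat.mul_div_cancel_left _ (by positivity), Nat.mul_mod_right]
    · rintro ⟨⟨c, rfl⟩, h⟩
      rw [Nat.mul_div_cancel_left _ (by positivity)] at h
      rw [pow_succ]
      exact Nat.mul_dvd_mul_left _ (Nat.dvd_of_mod_eq_zero h)

lemma chi_pos (hb : 2 ≤ b) {a : ℕ} (ha : 0 < a) : 0 < chi b a :=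
  (Nat.zero_le _).trans_lt (strictMono_chi hb ha)

lemma multiplicity_chi (hb : 2 ≤ b) {a : ℕ} (ha : 0 < a) :
    multiplicity (b + 1) (chi b a) = multiplicity b a := by
  rw [mult_eq_iff (by omega) (chi_pos hb ha), pow_dvd_iff_digits (by omega),
    pow_dvd_iff_digits (by omega)]
  simp only [chi_digit hb]
  rw [← pow_dvd_iff_digits hb, ← pow_dvd_iff_digits hb, ← mult_eq_iff hb ha]

end chi

section iota

variable {m : ℕ}

/-- The values of `ι_m`. -/
def IotaVal (m a : ℕ) : Prop := a = 0 ∨ multiplicity (m + 1) a ∈ Vset m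

lemma infinite_of_strictMono {p q : ℕ → Prop} {f : ℕ → ℕ} (hp : {k | p k}.Infinite)
    (hf : ∀ k, p k → k ∈ Set.range f) (hq : ∀ a, p (f a) ↔ q a) : {a | q a}.Infinite := by
  intro h
  refine hp ((h.image f).subset fun k hk => ?_)
  obtain ⟨a, rfl⟩ := hf k hk
  exact ⟨a, (hq a).1 hk, rfl⟩

lemma nth_eq_of_strictMono {p q : ℕ → Prop} {f : ℕ → ℕ} (hf : StrictMono f)
    (hp : {k | p k}.Infinite) (hr : ∀ k, p k → k ∈ Set.range f) (hq : ∀ a, p (f a) ↔ q a)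
    (x : ℕ) : Nat.nth p x = f (Nat.nth q x) := by
  rw [← Nat.nth_comp_of_strictMono hf hr fun hfi => absurd hfi hp]
  simp only [hq]

lemma infinite_curl_le_succ (hSH : StandingHyp) (hm : 1 ≤ m) :
    {k | curl (gPrefix (m + 1 + 1) k) ≤ m + 1}.Infinite :=
  (hSH (m + 1) (by omega)).2

lemma curl_gPrefix_chi_le_iff (hSH : StandingHyp) (hm : 2 ≤ m) (a : ℕ) :
    curl (gPrefix (m + 1) (blockWord (m + 1) (rulerBlock (m + 1)) (chi (m + 1) a)).length) ≤ m ↔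
      IotaVal m a := by
  have hT := infinite_curl_le_succ hSH (m := m) (by omega)
  rw [gPrefix_length_blockWord hT (by omega)]
  rcases Nat.eq_zero_or_pos a with rfl | ha
  · have : chi (m + 1) 0 = 0 := by simp [chi]
    rw [this, blockWord, curl_nil]
    exact iff_of_true (by omega) (.inl rfl)
  · rw [curl_blockWord_le_iff hT (by omega) (chi_pos (by omega) ha) hm, IotaVal,
      or_iff_right (by omega), rulerBlock, multiplicity_chi (by omega) ha]
    refine and_iff_left fun s => ?_
    rw [chi_digit (by omega)]
    exact Nat.lt_succ_iff.1 (Nat.mod_lt _ (by omega))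

lemma strictMono_length_blockWord_chi (hm : 2 ≤ m) : StrictMono fun a =>
    (blockWord (m + 1) (rulerBlock (m + 1)) (chi (m + 1) a)).length :=
  strictMono_length_blockWord.comp (strictMono_chi (by omega))

lemma mem_range_of_curl_le (hSH : StandingHyp) (hm : 2 ≤ m) (k : ℕ)
    (hk : curl (gPrefix (m + 1) k) ≤ m) : k ∈ Set.range fun a =>
    (blockWord (m + 1) (rulerBlock (m + 1)) (chi (m + 1) a)).length := by
  have hT := infinite_curl_le_succ hSH (m := m) (by omega)
  obtain ⟨y, rfl⟩ := exists_length_blockWord_of_curl_le hT (by omega) (hk.trans (by omega))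
  rcases Nat.eq_zero_or_pos y with rfl | hy
  · exact ⟨0, by simp [chi]⟩
  · rw [gPrefix_length_blockWord hT (by omega), curl_blockWord_le_iff hT (by omega) hy hm] at hk
    obtain ⟨a, rfl⟩ := exists_chi_eq (b := m + 1) (by omega) fun s => Nat.lt_succ_iff.2 (hk.2 s)
    exact ⟨a, rfl⟩

lemma infinite_iotaVal (hSH : StandingHyp) (hm : 2 ≤ m) : {a | IotaVal m a}.Infinite :=
  infinite_of_strictMono (hSH m (by omega)).2 (mem_range_of_curl_le hSH hm)
    (curl_gPrefix_chi_le_iff hSH hm)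

lemma iota_succ (hSH : StandingHyp) (hm : 2 ≤ m) (x : ℕ) :
    iota m (x + 1) = Nat.nth (IotaVal m) x := by
  have hT := infinite_curl_le_succ hSH (m := m) (by omega)
  rw [iota, Tstr, tau, Nat.add_sub_cancel, nth_eq_of_strictMono
    (strictMono_length_blockWord_chi hm) (hSH m (by omega)).2 (mem_range_of_curl_le hSH hm)
    (curl_gPrefix_chi_le_iff hSH hm), gPrefix_length_blockWord hT (by omega),
    count_blockWord (notMem_rulerBlock _), digits_chi (by omega), Nat.ofDigits_digits]

lemma iotaInv_eq_count (hSH : StandingHyp) (hm : 2 ≤ m) (p : ℕ) :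
    iotaInv m p = Nat.count (IotaVal m) (p + 1) := by
  have h1 : 1 ≤ Nat.count (IotaVal m) (p + 1) := by
    rw [Nat.count_succ', if_pos (.inl rfl)]
    omega
  have h2 : {x : ℕ | 1 ≤ x ∧ iota m x ≤ p} = Set.Icc 1 (Nat.count (IotaVal m) (p + 1)) := by
    ext x
    refine and_congr_right fun hx => ?_
    obtain ⟨x, rfl⟩ : ∃ y, x = y + 1 := ⟨x - 1, by omega⟩
    rw [iota_succ hSH hm, Nat.add_one_le_iff, Nat.lt_nth_iff_count_lt (infinite_iotaVal hSH hm),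
      Nat.lt_succ_iff]
  rw [iotaInv, h2, csSup_Icc h1]

lemma iotaInv_iota (hSH : StandingHyp) (hm : 2 ≤ m) {x : ℕ} (hx : 1 ≤ x) :
    iotaInv m (iota m x) = x := by
  obtain ⟨x, rfl⟩ : ∃ y, x = y + 1 := ⟨x - 1, by omega⟩
  have hinf := infinite_iotaVal hSH hm
  rw [iotaInv_eq_count hSH hm, iota_succ hSH hm, Nat.count_succ,
    if_pos (Nat.nth_mem_of_infinite hinf x), Nat.count_nth_of_infinite hinf]

lemma card_multiplicity_eq {b : ℕ} (hb : 2 ≤ b) (p v : ℕ) :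
    ((Finset.Ioc 0 p).filter fun a => multiplicity b a = v).card =
      p / b ^ v - p / b ^ (v + 1) := by
  have h : ((Finset.Ioc 0 p).filter fun a => multiplicity b a = v) =
      ((Finset.Ioc 0 p).filter fun a => b ^ v ∣ a) \
        ((Finset.Ioc 0 p).filter fun a => b ^ (v + 1) ∣ a) := by
    ext a
    simp only [Finset.mem_filter, Finset.mem_sdiff, not_and]
    constructor
    · rintro ⟨h1, h2⟩
      rw [mult_eq_iff hb (Finset.mem_Ioc.1 h1).1] at h2
      exact ⟨⟨h1, h2.1⟩, fun _ => h2.2⟩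
    · rintro ⟨⟨h1, h2⟩, h3⟩
      exact ⟨h1, (mult_eq_iff hb (Finset.mem_Ioc.1 h1).1 v).2 ⟨h2, h3 h1⟩⟩
  rw [h, Finset.card_sdiff_of_subset, Nat.Ioc_filter_dvd_card_eq_div,
    Nat.Ioc_filter_dvd_card_eq_div]
  exact Finset.monotone_filter_right _ fun a _ h => (pow_dvd_pow b (Nat.le_succ v)).trans h

lemma iotaInv_eq_sum (hSH : StandingHyp) (hm : 2 ≤ m) (p : ℕ) :
    iotaInv m p = 1 + ∑ v ∈ Finset.range (p + 1),
      (if v ∈ Vset m then p / (m + 1) ^ v - p / (m + 1) ^ (v + 1) else 0) := by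
  have hb : 2 ≤ m + 1 := by omega
  have hr : (Finset.range (p + 1)).filter (IotaVal m) =
      insert 0 ((Finset.Ioc 0 p).filter fun a => multiplicity (m + 1) a ∈ Vset m) := by
    ext a
    simp only [Finset.mem_filter, Finset.mem_range, Finset.mem_insert, Finset.mem_Ioc, IotaVal]
    constructor
    · rintro ⟨h1, h2⟩
      rcases Nat.eq_zero_or_pos a with h | h
      · exact .inl h
      · exact .inr ⟨by omega, h2.resolve_left (by omega)⟩
    · rintro (rfl | ⟨h1, h2⟩)
      · exact ⟨by omega, .inl rfl⟩
      · exact ⟨by omega, .inr h2⟩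
  rw [iotaInv_eq_count hSH hm, Nat.count_eq_card_filter_range, hr,
    Finset.card_insert_of_notMem (by simp), add_comm]
  congr 1
  rw [Finset.card_eq_sum_card_fiberwise (f := multiplicity (m + 1)) (t := Finset.range (p + 1))]
  · refine Finset.sum_congr rfl fun v _ => ?_
    rw [Finset.filter_filter]
    split_ifs with hv
    · rw [← card_multiplicity_eq hb]
      congr 1
      refine Finset.filter_congr fun a _ => ⟨fun h => h.2, fun h => ⟨by rwa [h], h⟩⟩
    · rw [Finset.card_eq_zero, Finset.filter_eq_empty_iff]
      rintro a _ ⟨h1, rfl⟩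
      exact hv h1
  · intro a ha
    simp only [Finset.coe_filter, Finset.mem_Ioc, Set.mem_ofPred_eq] at ha
    have h1 := ((mult_eq_iff hb ha.1.1 _).1 rfl).1
    have h2 := Nat.le_of_dvd ha.1.1 h1
    have h3 := Nat.lt_pow_self (n := multiplicity (m + 1) a) (show 1 < m + 1 by omega)
    simp only [Finset.coe_range, Set.mem_Iio]
    omega

end iota

section first_occurrence

variable {m : ℕ}

lemma gPrefix_eq_concat_gij {M p : ℕ} (hp : 1 ≤ p) :
    gPrefix M p = gPrefix M (p - 1) ++ [gij M p] := by
  obtain ⟨p, rfl⟩ : ∃ q, p = q + 1 := ⟨p - 1, by omega⟩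
  rfl

lemma mem_gPrefix_iff {M N n : ℕ} : n ∈ gPrefix M N ↔ ∃ p, 1 ≤ p ∧ p ≤ N ∧ gij M p = n := by
  induction N with
  | zero =>
    simp only [gPrefix, List.not_mem_nil, false_iff]
    rintro ⟨p, h1, h2, -⟩
    omega
  | succ N ih =>
    rw [gPrefix_eq_concat_gij (by omega), Nat.add_sub_cancel, List.mem_append, ih,
      List.mem_singleton]
    constructor
    · rintro (⟨p, h1, h2, h3⟩ | rfl)
      · exact ⟨p, h1, by omega, h3⟩
      · exact ⟨N + 1, by omega, le_rfl, rfl⟩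
    · rintro ⟨p, h1, h2, rfl⟩
      rcases h2.eq_or_lt with rfl | h2
      · exact .inr rfl
      · exact .inl ⟨p, h1, by omega, rfl⟩

lemma zero_mem_Vset (hm : 1 ≤ m) : 0 ∈ Vset m := by
  have h : tau (m + 1) 1 = 0 := by
    rw [tau, Nat.sub_self, Nat.nth_zero_of_zero]
    rw [gPrefix, curl_nil]
    omega
  rw [Vset, Set.mem_ofPred_eq, Tstr, h, gPrefix, curl_nil]
  exact hm

lemma tfun_sub_one_mem_Vset (hSH : StandingHyp) (hm : 2 ≤ m) {n : ℕ} (hn : m + 1 ≤ n)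
    (hne : {p : ℕ | 1 ≤ p ∧ gij (m + 1) p = n}.Nonempty) : tfun (m + 1) n - 1 ∈ Vset m := by
  have hT := infinite_curl_le_succ hSH (m := m) (by omega)
  have hM : 2 ≤ m + 1 := by omega
  rw [tfun, Nat.add_sub_cancel_left]
  obtain ⟨hp1, hpn⟩ : 1 ≤ phi (m + 1) n ∧ gij (m + 1) (phi (m + 1) n) = n := Nat.sInf_mem hne
  have hmin : ∀ N, n ∈ gPrefix (m + 1) N → phi (m + 1) n ≤ N := by
    intro N hN
    obtain ⟨q, h1, h2, h3⟩ := mem_gPrefix_iff.1 hN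
    exact (Nat.sInf_le (show q ∈ {p | 1 ≤ p ∧ gij (m + 1) p = n} from ⟨h1, h3⟩)).trans h2
  generalize phi (m + 1) n = p at *
  rcases hn.eq_or_lt with rfl | hn
  · have h1 : p = 1 := le_antisymm (hmin 1 (by simp [gPrefix, curl_nil])) hp1
    subst h1
    have h2 : gPrefix (m + 1) 1 = [m + 1] := by simp [gPrefix, curl_nil]
    rw [h2]
    simpa using zero_mem_Vset (m := m) (by omega)
  · obtain ⟨y, U, hU, hPU⟩ := gPrefix_eq_partial hT hM (show 0 < p by omega)
    have hMU : m + 1 ∉ U := fun h => notMem_rulerBlock _ _ (hU.subset h)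
    have hcount : (gPrefix (m + 1) p).count (m + 1) = y + 1 := by
      rw [hPU, List.count_append, count_blockWord (notMem_rulerBlock _), List.count_cons_self,
        List.count_eq_zero_of_not_mem hMU]
    rw [hcount]
    have hlast := gPrefix_eq_concat_gij (M := m + 1) hp1
    rw [hpn] at hlast
    have hnot : n ∉ gPrefix (m + 1) (p - 1) := fun h => by
      have := hmin _ h
      omega
    rcases List.eq_nil_or_concat U with rfl | ⟨U', x, hUx⟩
    · rw [hlast] at hPU
      have := (List.append_inj' hPU rfl).2
      simp only [List.cons.injEq, and_true] at this
      omega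
    rw [List.concat_eq_append] at hUx
    subst hUx
    have h1 : gPrefix (m + 1) (p - 1) ++ [n] =
        (blockWord (m + 1) (rulerBlock (m + 1)) y ++ (m + 1) :: U') ++ [x] := by
      rw [← hlast, hPU]
      simp
    obtain ⟨h2, h3⟩ := List.append_inj' h1 rfl
    obtain rfl : n = x := by simpa using h3
    have hcurl : curl (U' ++ [n]) ≤ 1 := curl_concat_of_notMem fun h => hnot (by rw [h2]; simp [h])
    have hUeq := eq_gPrefix_of_isPrefix hU
    obtain ⟨j, hj⟩ := exists_eq_Tstr (M := m + 1) (k := (U' ++ [n]).length)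
      (by rw [← hUeq]; omega)
    rw [← hUeq] at hj
    rw [hj] at hU hcurl
    have hjle := le_of_Tstr_isPrefix hT hU
    have hpos : 0 < (m + 2) ^ j := by positivity
    have hmul : multiplicity (m + 2) ((m + 2) ^ j) = j := by
      rw [mult_eq_iff (by omega) hpos]
      exact ⟨dvd_rfl, fun h => absurd (Nat.le_of_dvd hpos h)
        (not_le.2 (Nat.pow_lt_pow_right (by omega) (by omega)))⟩
    have hdvd : (m + 2) ^ j ∣ y + 1 := (pow_dvd_iff_le_mult (by omega) (by omega) _).2 hjle
    have hy : y + 1 = (m + 2) ^ j := by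
      refine le_antisymm ?_ (Nat.le_of_dvd (by omega) hdvd)
      by_contra! hlt
      apply hnot
      rw [h2, List.mem_append]
      refine .inl ((blockWord_mono (show (m + 2) ^ j ≤ y by omega)).subset ?_)
      obtain ⟨z, hz⟩ : ∃ z, (m + 2) ^ j = z + 1 := ⟨(m + 2) ^ j - 1, by omega⟩
      rw [hz, blockWord, ← hz, rulerBlock, hmul, ← hj]
      simp
    rw [hy, Nat.log_pow (by omega), Vset, Set.mem_ofPred_eq]
    exact hcurl.trans (by omega)

end first_occurrence

section density

variable {m : ℕ}

/-- The density of the positive integers whose `(m+1)`-adic valuation is `v`, when `v ∈ V_m`. -/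
noncomputable def valDensity (m : ℕ) : ℕ → ℝ :=
  (Vset m).indicator fun v => (m : ℝ) / ((m : ℝ) + 1) * (1 / ((m : ℝ) + 1)) ^ v

lemma tsum_valDensity (m : ℕ) : ∑' v, valDensity m v =
    ((m : ℝ) / ((m : ℝ) + 1)) * ∑' v : ↥(Vset m), (1 / ((m : ℝ) + 1)) ^ (v : ℕ) := by
  rw [← tsum_mul_left, valDensity, ← tsum_subtype]

lemma valDensity_nonneg (m v : ℕ) : 0 ≤ valDensity m v :=
  Set.indicator_nonneg (fun _ _ => by positivity) _

lemma valDensity_le (m v : ℕ) :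
    valDensity m v ≤ (m : ℝ) / ((m : ℝ) + 1) * (1 / ((m : ℝ) + 1)) ^ v :=
  Set.indicator_le_self' (fun _ _ => by positivity) _

lemma hasSum_geometric_density (hm : 1 ≤ m) :
    HasSum (fun v : ℕ => (m : ℝ) / ((m : ℝ) + 1) * (1 / ((m : ℝ) + 1)) ^ v) 1 := by
  have hm0 : (0 : ℝ) < m := by exact_mod_cast hm
  have h := (hasSum_geometric_of_lt_one (r := 1 / ((m : ℝ) + 1)) (by positivity)
    (by rw [div_lt_one (by positivity)]; linarith)).mul_left ((m : ℝ) / ((m : ℝ) + 1))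
  rwa [one_sub_div (by positivity), add_sub_cancel_right, inv_div,
    div_mul_div_cancel₀ (by positivity), div_self hm0.ne'] at h

lemma summable_valDensity (hm : 1 ≤ m) : Summable (valDensity m) :=
  .of_nonneg_of_le (valDensity_nonneg m) (valDensity_le m) (hasSum_geometric_density hm).summable

lemma div_pow_eq_zero (hm : 1 ≤ m) {p v : ℕ} (hv : p + 1 ≤ v) : p / (m + 1) ^ v = 0 :=
  Nat.div_eq_of_lt ((show p < v by omega).trans (Nat.lt_pow_self (by omega)))

lemma tendsto_nat_div_div (q : ℕ) :
    Tendsto (fun p : ℕ => ((p / q : ℕ) : ℝ) / p) atTop (nhds (1 / q)) := by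
  have h := (tendsto_nat_floor_mul_div_atTop (R := ℝ) (a := 1 / q) (by positivity)).comp
    tendsto_natCast_atTop_atTop
  refine h.congr fun p => ?_
  rw [Function.comp_apply, one_div_mul_eq_div, Nat.floor_div_eq_div]

lemma tendsto_iotaInv_div (hSH : StandingHyp) (hm : 2 ≤ m) :
    Tendsto (fun p : ℕ => (iotaInv m p : ℝ) / p) atTop (nhds (∑' v, valDensity m v)) := by
  have hm0 : (0 : ℝ) < m := by exact_mod_cast (show 0 < m by omega)
  set F : ℕ → ℕ → ℝ := fun p => (Vset m).indicator fun v =>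
    ((p / (m + 1) ^ v : ℕ) : ℝ) / p - ((p / (m + 1) ^ (v + 1) : ℕ) : ℝ) / p with hF
  have h1 : ∀ p : ℕ, (iotaInv m p : ℝ) / p = 1 / p + ∑' v, F p v := by
    intro p
    rw [tsum_eq_sum (s := Finset.range (p + 1)), iotaInv_eq_sum hSH hm, Nat.cast_add, add_div,
      Nat.cast_sum, Finset.sum_div, Nat.cast_one]
    · congr 1
      refine Finset.sum_congr rfl fun v _ => ?_
      simp only [hF, Set.indicator_apply]
      split_ifs
      · rw [Nat.cast_sub, sub_div]
        exact Nat.div_le_div_left (Nat.pow_le_pow_right (by omega) (by omega)) (by positivity)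
      · simp
    · intro v hv
      rw [Finset.mem_range, not_lt] at hv
      simp only [hF, Set.indicator_apply]
      rw [div_pow_eq_zero (by omega) hv, div_pow_eq_zero (by omega) (by omega)]
      simp
  simp only [h1]
  rw [← zero_add (∑' v, valDensity m v)]
  refine tendsto_one_div_atTop_nhds_zero_nat.add
    (tendsto_tsum_of_dominated_convergence (bound := fun v => (1 / ((m : ℝ) + 1)) ^ v)
      (summable_geometric_of_lt_one (by positivity)
        (by rw [div_lt_one (by positivity)]; linarith)) (fun v => ?_) (.of_forall fun p v => ?_))
  · simp only [hF, valDensity, Set.indicator_apply]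
    split_ifs
    · convert (tendsto_nat_div_div ((m + 1) ^ v)).sub (tendsto_nat_div_div ((m + 1) ^ (v + 1)))
        using 2
      push_cast
      rw [div_pow, one_pow]
      field_simp
      ring
    · exact tendsto_const_nhds
  · simp only [hF, Set.indicator_apply]
    split_ifs
    · have h2 : ((p / (m + 1) ^ (v + 1) : ℕ) : ℝ) ≤ (p / (m + 1) ^ v : ℕ) := by
        exact_mod_cast Nat.div_le_div_left (Nat.pow_le_pow_right (by omega) (by omega))
          (by positivity)
      have h3 : ((p / (m + 1) ^ v : ℕ) : ℝ) ≤ p / ((m : ℝ) + 1) ^ v := by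
        refine Nat.cast_div_le.trans_eq ?_
        push_cast
        rfl
      rw [← sub_div, Real.norm_of_nonneg (div_nonneg (by linarith) (by positivity))]
      refine div_le_of_le_mul₀ (by positivity) (by positivity) ?_
      rw [div_pow, one_pow, one_div_mul_eq_div]
      have : (0 : ℝ) ≤ (p / (m + 1) ^ (v + 1) : ℕ) := by positivity
      linarith
    · rw [norm_zero]
      positivity

lemma tendsto_iota (hSH : StandingHyp) (hm : 2 ≤ m) : Tendsto (iota m) atTop atTop := by
  rw [← tendsto_add_atTop_iff_nat 1]
  simp only [iota_succ hSH hm]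
  exact (Nat.nth_strictMono (infinite_iotaVal hSH hm)).tendsto_atTop

lemma tendsto_div_iota (hSH : StandingHyp) (hm : 2 ≤ m) :
    Tendsto (fun x : ℕ => (x : ℝ) / (iota m x : ℝ)) atTop (nhds (∑' v, valDensity m v)) := by
  refine ((tendsto_iotaInv_div hSH hm).comp (tendsto_iota hSH hm)).congr' ?_
  filter_upwards [eventually_ge_atTop 1] with x hx
  rw [Function.comp_apply, iotaInv_iota hSH hm hx]

lemma iotaInv_pow (hSH : StandingHyp) (hm : 2 ≤ m) {t : ℕ} (ht : t ∈ Vset m) :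
    (iotaInv m ((m + 1) ^ t) : ℝ) =
      2 + (∑ v ∈ Finset.range t, valDensity m v) * ((m : ℝ) + 1) ^ t := by
  have hlt : t < (m + 1) ^ t := Nat.lt_pow_self (by omega)
  rw [iotaInv_eq_sum hSH hm, ← Finset.sum_subset (s₁ := Finset.range (t + 1)),
    Finset.sum_range_succ, if_pos ht, Nat.div_self (by positivity),
    Nat.div_eq_of_lt (Nat.pow_lt_pow_right (by omega) (by omega)), Finset.sum_mul]
  · push_cast
    have : ∀ v ∈ Finset.range t, (((if v ∈ Vset m then
        (m + 1) ^ t / (m + 1) ^ v - (m + 1) ^ t / (m + 1) ^ (v + 1) else 0 : ℕ)) : ℝ) =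
        valDensity m v * ((m : ℝ) + 1) ^ t := by
      intro v hv
      obtain ⟨e, rfl⟩ := Nat.exists_eq_add_of_le (Nat.succ_le_of_lt (Finset.mem_range.1 hv))
      rw [valDensity, Set.indicator_apply]
      split_ifs
      · rw [Nat.pow_div (by omega) (by omega), Nat.pow_div (by omega) (by omega),
          show v.succ + e - v = e + 1 by omega, show v.succ + e - (v + 1) = e by omega, pow_succ',
          ← Nat.sub_one_mul, Nat.add_sub_cancel]
        push_cast
        rw [div_pow, one_pow, Nat.succ_eq_add_one]
        field_simp
        ring
      · simp
    rw [← Finset.sum_congr rfl this]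
    push_cast
    ring
  · exact Finset.range_subset_range.2 (by omega)
  · intro v _ hv
    rw [Finset.mem_range, not_lt] at hv
    rw [Nat.div_eq_of_lt (Nat.pow_lt_pow_right (by omega) (show t < v by omega)), Nat.zero_sub,
      ite_self]

lemma iotaInv_pow_sub_one (hSH : StandingHyp) (hm : 2 ≤ m) {t : ℕ} (ht : t ∈ Vset m) :
    (iotaInv m ((m + 1) ^ t) : ℤ) - 1 = ⌈(∑' v, valDensity m v) * ((m : ℝ) + 1) ^ t⌉ := by
  have hm0 : (0 : ℝ) < m := by exact_mod_cast (show 0 < m by omega)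
  have hs := summable_valDensity (m := m) (by omega)
  have hs' : Summable fun v => valDensity m (v + t) := (summable_nat_add_iff t).2 hs
  have hpos : 0 < ∑' v, valDensity m (v + t) := by
    refine hs'.tsum_pos (fun v => valDensity_nonneg m _) 0 ?_
    rw [zero_add, valDensity, Set.indicator_of_mem ht]
    positivity
  have hle : ∑' v, valDensity m (v + t) ≤ (1 / ((m : ℝ) + 1)) ^ t := by
    have h1 := (hasSum_geometric_density (m := m) (by omega)).mul_right ((1 / ((m : ℝ) + 1)) ^ t)
    rw [one_mul] at h1
    rw [← h1.tsum_eq]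
    refine hs'.tsum_le_tsum (fun v => (valDensity_le m _).trans_eq ?_) h1.summable
    rw [pow_add]
    ring
  have hb : (0 : ℝ) < ((m : ℝ) + 1) ^ t := by positivity
  have hle' := mul_le_mul_of_nonneg_right hle hb.le
  rw [← mul_pow, one_div_mul_cancel (by positivity), one_pow] at hle'
  have hpos' := mul_pos hpos hb
  rw [eq_comm, Int.ceil_eq_iff, ← hs.sum_add_tsum_nat_add t, add_mul]
  push_cast
  rw [iotaInv_pow hSH hm ht]
  constructor <;> linarith

end density

/-- Proposition `num propo`. Let `m ≥ 2`. (1) For `p ≥ 1`,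
`ι_m⁻¹(p) = 1 + Σ_{v ∈ V_m} (⌊p/(m+1)^v⌋ − ⌊p/(m+1)^{v+1}⌋)` (only `v ≤ p` contribute).
(2) `ν_m := lim x/ι_m(x)` exists and equals `(m/(m+1))·Σ_{v ∈ V_m} (m+1)^{-v}`.
(3) For `n ≥ m+1` and `t := t^(m+1)(n) − 1`, `ι_m⁻¹((m+1)^t) − 1 = ⌈ν_m·(m+1)^t⌉`. -/
theorem statement9 (hSH : StandingHyp) (m : ℕ) (hm : 2 ≤ m) :
    (∀ p : ℕ, 1 ≤ p → iotaInv m p =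
      1 + ∑ v ∈ Finset.range (p + 1),
        (if v ∈ Vset m then p / (m + 1) ^ v - p / (m + 1) ^ (v + 1) else 0)) ∧
    ∃ ν : ℝ,
      Tendsto (fun x : ℕ => (x : ℝ) / (iota m x : ℝ)) atTop (nhds ν) ∧
      ν = ((m : ℝ) / ((m : ℝ) + 1)) * ∑' v : ↥(Vset m), (1 / ((m : ℝ) + 1)) ^ (v : ℕ) ∧
      (∀ n : ℕ, m + 1 ≤ n → {p : ℕ | 1 ≤ p ∧ gij (m + 1) p = n}.Nonempty →
        (iotaInv m ((m + 1) ^ (tfun (m + 1) n - 1)) : ℤ) - 1 =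
          ⌈ν * ((m : ℝ) + 1) ^ (tfun (m + 1) n - 1)⌉) := by
  refine ⟨fun p _ => iotaInv_eq_sum hSH hm p, ∑' v, valDensity m v, tendsto_div_iota hSH hm,
    tsum_valDensity m, fun n hn hne => ?_⟩
  exact iotaInv_pow_sub_one hSH hm (tfun_sub_one_mem_Vset hSH hm hn hne)
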